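/- arXiv:2201.05204 — 4 statements merged into one kernel-verified Lean document; each statement's English description precedes it below -/
import Mathlib

section
/- Fix λ > 0 and let τ be a real random variable uniformly distributed in [−λ,λ]. Define φ_λ(x) = (|x|−λ)·1_{|x| ≥ λ}. Then for every a, b ∈ ℝ, | 2λ·P(sign(a+τ) ≠ sign(b+τ)) − |a−b| | ≤ φ_λ(a) + φ_λ(b). -/
open MeasureTheory ProbabilityTheory Real

noncomputable section

/-- sign function with values in {-1,1}. -/
def signPM (s : ℝ) : ℝ := if 0 ≤ s then 1 else -1

/-- uniform distribution on the interval [-λ,λ]. -/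
def unifIcc (lam : ℝ) : Measure ℝ :=
  (ENNReal.ofReal (2 * lam))⁻¹ • volume.restrict (Set.Icc (-lam) lam)

/-- φ_λ(x) = (|x| - λ)·1_{|x| ≥ λ}. -/
def phiLam (lam x : ℝ) : ℝ := if lam ≤ |x| then |x| - lam else 0

/-- For `a ≤ b`, the signs of `a + t` and `b + t` differ exactly when `-b ≤ t < -a`. -/
theorem setOf_signPM_ne {a b : ℝ} (hab : a ≤ b) :
    {t | signPM (a + t) ≠ signPM (b + t)} = Set.Ico (-b) (-a) := by
  ext t
  simp only [signPM, Set.mem_ofPred_eq, Set.mem_Ico]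
  constructor
  · intro h
    split_ifs at h with h₁ h₂ h₂
    · exact absurd rfl h
    · linarith
    · constructor <;> linarith
    · exact absurd rfl h
  · rintro ⟨h₁, h₂⟩
    rw [if_neg (by linarith), if_pos (by linarith)]
    norm_num

/-- The measure of a half-open interval under the uniform distribution on `[-lam, lam]`. -/
theorem two_mul_unifIcc_Ico {lam : ℝ} (hlam : 0 < lam) (c d : ℝ) :
    2 * lam * (unifIcc lam (Set.Ico c d)).toReal = max (min d lam - max c (-lam)) 0 := by
  have hvol : volume (Set.Ico c d ∩ Set.Icc (-lam) lam)
      = ENNReal.ofReal (min d lam - max c (-lam)) := by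
    rw [measure_congr (Ico_ae_eq_Icc.inter (ae_eq_refl (Set.Icc (-lam) lam))),
      Set.Icc_inter_Icc, Real.volume_Icc]
  rw [unifIcc, Measure.smul_apply, Measure.restrict_apply measurableSet_Ico, hvol, smul_eq_mul,
    ENNReal.toReal_mul, ENNReal.toReal_inv, ENNReal.toReal_ofReal (by positivity),
    ENNReal.toReal_ofReal']
  field_simp

theorem phiLam_eq_max (lam x : ℝ) : phiLam lam x = max (|x| - lam) 0 := by
  unfold phiLam
  split_ifs with h
  · rw [max_eq_left (by linarith)]
  · rw [max_eq_right (by linarith)]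

/-- Lemma 2.2: |2λ P(sign(a+τ) ≠ sign(b+τ)) - |a-b|| ≤ φ_λ(a) + φ_λ(b). -/
theorem abs_two_lam_sep_prob_sub_abs_le (lam : ℝ) (hlam : 0 < lam) (a b : ℝ) :
    abs (2 * lam * (unifIcc lam {t | signPM (a + t) ≠ signPM (b + t)}).toReal - |a - b|)
      ≤ phiLam lam a + phiLam lam b := by
  wlog hab : a ≤ b generalizing a b
  · have h := this b a (le_of_not_ge hab)
    simpa only [ne_comm, abs_sub_comm b a, add_comm (phiLam lam b)] using h
  rw [setOf_signPM_ne hab, two_mul_unifIcc_Ico hlam, phiLam_eq_max, phiLam_eq_max,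
    abs_sub_comm a b, abs_of_nonneg (sub_nonneg.2 hab)]
  have ha₁ := le_max_left (|a| - lam) 0
  have ha₂ := le_max_right (|a| - lam) 0
  have hb₁ := le_max_left (|b| - lam) 0
  have hb₂ := le_max_right (|b| - lam) 0
  have ha₃ := le_abs_self a
  have ha₄ := neg_le_abs a
  have hb₃ := le_abs_self b
  have hb₄ := neg_le_abs b
  rw [abs_le]
  rcases max_cases (min (-a) lam - max (-b) (-lam)) 0 with ⟨h₃, h₄⟩ | ⟨h₃, h₄⟩ <;>
    rw [h₃] <;>
    rcases min_cases (-a) lam with ⟨h₁, _⟩ | ⟨h₁, _⟩ <;>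
    rcases max_cases (-b) (-lam) with ⟨h₂, _⟩ | ⟨h₂, _⟩ <;>
    rw [h₁, h₂] at h₄ <;>
    constructor <;> linarith

end
end

section
/- There are absolute constants c, C > 0 such that the following holds. Let T ⊆ ℝ^n be nonempty and bounded and let A : ℝ^n → ℝ^m be a standard gaussian matrix. Then for every u ≥ 1 and every 1 ≤ k ≤ m, with probability at least 1 − 2·exp(−c·u²·k·log(em/k)), sup_{t∈T} ‖At‖_{[k]} ≤ C·( ℓ_*(T) + u·R(T)·√(k·log(em/k)) ). -/
open MeasureTheory ProbabilityTheory Real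

noncomputable section

/-- Euclidean norm on `Fin n → ℝ`. -/
def enorm2 {n : ℕ} (x : Fin n → ℝ) : ℝ := Real.sqrt (∑ i, (x i)^2)

/-- Euclidean inner product. -/
def ip {n : ℕ} (x y : Fin n → ℝ) : ℝ := ∑ i, x i * y i

/-- componentwise sign. -/
def signVec {m : ℕ} (v : Fin m → ℝ) : Fin m → ℝ := fun i => signPM (v i)

/-- Hamming distance. -/
def hamming {m : ℕ} (u v : Fin m → ℝ) : ℕ := (Finset.univ.filter fun i => u i ≠ v i).card

def mulVecR {m n : ℕ} (A : Fin m → Fin n → ℝ) (x : Fin n → ℝ) : Fin m → ℝ :=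
  fun i => ∑ j, A i j * x j

def l1norm {m : ℕ} (v : Fin m → ℝ) : ℝ := ∑ i, |v i|

/-- the norm ‖v‖_{[s]}. -/
def knorm {m : ℕ} (s : ℕ) (v : Fin m → ℝ) : ℝ :=
  sSup {r | ∃ I : Finset (Fin m), I.card = s ∧ r = Real.sqrt (∑ i ∈ I, (v i)^2)}

/-- standard gaussian measure on ℝ^n. -/
def gaussianPi (n : ℕ) : Measure (Fin n → ℝ) := Measure.pi fun _ => gaussianReal 0 1

instance (n : ℕ) : IsProbabilityMeasure (gaussianPi n) := by
  unfold gaussianPi; infer_instance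

/-- standard gaussian m × n matrix distribution (rows). -/
def gaussianMatrix (m n : ℕ) : Measure (Fin m → Fin n → ℝ) := Measure.pi fun _ => gaussianPi n

instance (m n : ℕ) : IsProbabilityMeasure (gaussianMatrix m n) := by
  unfold gaussianMatrix; infer_instance

/-- uniform distribution on the cube [-λ,λ]^m. -/
def unifCube (m : ℕ) (lam : ℝ) : Measure (Fin m → ℝ) :=
  (ENNReal.ofReal ((2*lam)^m))⁻¹ • volume.restrict (Set.univ.pi fun _ => Set.Icc (-lam) lam)

instance (m : ℕ) (lam : ℝ) : SFinite (unifCube m lam) := by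
  unfold unifCube; infer_instance

/-- gaussian mean width. -/
def meanWidth {n : ℕ} (T : Set (Fin n → ℝ)) : ℝ :=
  ∫ g, sSup ((fun t => |ip g t|) '' T) ∂(gaussianPi n)

/-- Dvoretzky–Milman dimension. -/
def dstar {n : ℕ} (T : Set (Fin n → ℝ)) : ℝ :=
  (meanWidth T / sSup (enorm2 '' T))^2

/-- covering number. -/
def coveringNumber {n : ℕ} (T : Set (Fin n → ℝ)) (θ : ℝ) : ℕ :=
  sInf {N : ℕ | ∃ F : Finset (Fin n → ℝ), F.card = N ∧ T ⊆ ⋃ c ∈ F, {x | enorm2 (x - c) < θ}}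

/-- the difference set T - T. -/
def diffSet {n : ℕ} (T : Set (Fin n → ℝ)) : Set (Fin n → ℝ) :=
  {z | ∃ a ∈ T, ∃ b ∈ T, z = a - b}

/-- closed euclidean ball of radius r. -/
def ballE (n : ℕ) (r : ℝ) : Set (Fin n → ℝ) := {z | enorm2 z ≤ r}

lemma charFunDual_gaussianPi {n : ℕ} (L : StrongDual ℝ (Fin n → ℝ)) :
    charFunDual (gaussianPi n) L = Complex.exp (-(∑ j, (L (Pi.single j 1) : ℂ) ^ 2) / 2) := by
  unfold gaussianPi
  rw [charFunDual_pi]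
  have h : ∀ j, charFunDual (gaussianReal 0 1) (L.comp (.single ℝ (fun _ : Fin n => ℝ) j))
      = Complex.exp (-(L (Pi.single j 1) : ℂ) ^ 2 / 2) := by
    intro j
    rw [charFunDual_eq_charFun_map_one, gaussianReal_map_continuousLinearMap, charFun_gaussianReal]
    congr 1
    simp [max_eq_left (sq_nonneg _), neg_div]
  simp_rw [h, ← Complex.exp_sum]
  congr 1
  rw [← Finset.sum_neg_distrib, Finset.sum_div]

lemma charFunDual_gaussianMatrix {m n : ℕ} (L : StrongDual ℝ (Fin m → Fin n → ℝ)) :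
    charFunDual (gaussianMatrix m n) L =
      Complex.exp (-(∑ i, ∑ j, (L (Pi.single i (Pi.single j 1)) : ℂ) ^ 2) / 2) := by
  unfold gaussianMatrix
  rw [charFunDual_pi]
  simp_rw [charFunDual_gaussianPi, ← Complex.exp_sum]
  congr 1
  rw [← Finset.sum_neg_distrib, Finset.sum_div]
  rfl

lemma map_add_sub_gaussianPi (n : ℕ) :
    ((gaussianPi n).prod (gaussianPi n)).map
      (fun p => ((√2)⁻¹ • (p.1 + p.2), (√2)⁻¹ • (p.1 - p.2))) =
      (gaussianPi n).prod (gaussianPi n) := by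
  let E := Fin n → ℝ
  let Φ : (E × E) →L[ℝ] (E × E) :=
    ((√2)⁻¹ • (ContinuousLinearMap.fst ℝ E E + ContinuousLinearMap.snd ℝ E E)).prod
      ((√2)⁻¹ • (ContinuousLinearMap.fst ℝ E E - ContinuousLinearMap.snd ℝ E E))
  change Measure.map Φ _ = _
  have : IsFiniteMeasure (((gaussianPi n).prod (gaussianPi n)).map Φ) := by infer_instance
  refine Measure.ext_of_charFunDual ?_
  ext L
  rw [charFunDual_map, charFunDual_prod, charFunDual_prod]
  simp_rw [charFunDual_gaussianPi, ← Complex.exp_add]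
  congr 1
  rw [← add_div, ← add_div, ← neg_add, ← neg_add, ← Finset.sum_add_distrib,
    ← Finset.sum_add_distrib]
  congr 2
  refine Finset.sum_congr rfl fun j _ => ?_
  norm_cast
  set a := L (Pi.single j 1, 0)
  set b := L (0, Pi.single j 1)
  have h1 : L (Φ (Pi.single j 1, 0)) = (√2)⁻¹ * (a + b) := by
    have : Φ (Pi.single j 1, 0) = (√2)⁻¹ • ((Pi.single j 1, 0) + (0, Pi.single j 1)) := by
      simp [Φ]
    rw [this, map_smul, map_add, smul_eq_mul]
  have h2 : L (Φ (0, Pi.single j 1)) = (√2)⁻¹ * (a - b) := by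
    have : Φ (0, Pi.single j 1) = (√2)⁻¹ • ((Pi.single j 1, 0) - (0, Pi.single j 1)) := by
      simp [Φ]
    rw [this, map_smul, map_sub, smul_eq_mul]
  simp only [ContinuousLinearMap.comp_apply, ContinuousLinearMap.inl_apply,
    ContinuousLinearMap.inr_apply]
  rw [h1, h2, mul_pow, mul_pow, inv_pow, Real.sq_sqrt (by norm_num)]
  ring

lemma map_vecMul_gaussianMatrix {m n : ℕ} (y : Fin m → ℝ) (hy : ∑ i, y i ^ 2 = 1) :
    (gaussianMatrix m n).map (fun A => ∑ i, y i • A i) = gaussianPi n := by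
  let Φ : (Fin m → Fin n → ℝ) →L[ℝ] (Fin n → ℝ) :=
    ∑ i, y i • ContinuousLinearMap.proj (R := ℝ) (φ := fun _ : Fin m => Fin n → ℝ) i
  have hΦ : ∀ A, Φ A = ∑ i, y i • A i := fun A => by
    simp [Φ]
  have hΦ' : (fun A => ∑ i, y i • A i) = Φ := by
    ext1 A; exact (hΦ A).symm
  rw [hΦ']
  refine Measure.ext_of_charFunDual ?_
  ext L
  rw [charFunDual_map, charFunDual_gaussianMatrix, charFunDual_gaussianPi]
  congr 3
  rw [Finset.sum_comm]
  refine Finset.sum_congr rfl fun j _ => ?_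
  have h : ∀ i, L.comp Φ (Pi.single i (Pi.single j 1)) = y i * L (Pi.single j 1) := by
    intro i
    rw [ContinuousLinearMap.comp_apply, hΦ, Finset.sum_eq_single i]
    · simp
    · intro b _ hb
      simp [hb]
    · simp
  norm_cast
  simp_rw [h, mul_pow, ← Finset.sum_mul, hy, one_mul]

lemma continuous_ip_left {n : ℕ} (t : Fin n → ℝ) : Continuous fun g => ip g t := by
  unfold ip; fun_prop

lemma map_ip_gaussianPi {n : ℕ} (t : Fin n → ℝ) :
    (gaussianPi n).map (fun g => ip g t) = gaussianReal 0 (∑ i, t i ^ 2).toNNReal := by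
  have hpos : 0 ≤ ∑ i, t i ^ 2 := by positivity
  have : IsProbabilityMeasure ((gaussianPi n).map (fun g => ip g t)) :=
    Measure.isProbabilityMeasure_map (continuous_ip_left t).measurable.aemeasurable
  let Φ : (Fin n → ℝ) →L[ℝ] ℝ :=
    ∑ i, t i • ContinuousLinearMap.proj (R := ℝ) (φ := fun _ : Fin n => ℝ) i
  have hΦ : ∀ g, Φ g = ip g t := fun g => by
    simp [Φ, ip, mul_comm]
  have hΦ' : (fun g => ip g t) = Φ := by
    ext1 A; exact (hΦ A).symm
  rw [hΦ']
  refine Measure.ext_of_charFun ?_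
  ext s
  rw [charFun_eq_charFunDual_toDualMap, charFunDual_map, charFunDual_gaussianPi,
    charFun_gaussianReal]
  congr 1
  have h : ∀ i, (((InnerProductSpace.toDualMap ℝ ℝ) s).comp Φ) (Pi.single i 1) = t i * s := by
    intro i
    simp [hΦ, ip, Pi.single_apply]
  simp_rw [h]
  push_cast
  simp_rw [mul_pow, ← Finset.sum_mul]
  simp [max_eq_left hpos]
  ring

lemma gaussianPi_abs_ip_gt_le {n : ℕ} (t : Fin n → ℝ) {R s : ℝ} (ht : enorm2 t ≤ R)
    (hs : 0 ≤ s) :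
    gaussianPi n {g | s * R < |ip g t|} ≤ ENNReal.ofReal (2 * Real.exp (-s ^ 2 / 2)) := by
  set v : NNReal := (∑ i, t i ^ 2).toNNReal with hv
  have hvt : (v : ℝ) = ∑ i, t i ^ 2 := Real.coe_toNNReal _ (by positivity)
  have hvR : (v : ℝ) = enorm2 t ^ 2 := by
    rw [enorm2, Real.sq_sqrt (by positivity), hvt]
  rcases eq_or_ne v 0 with h0 | h0
  · have ht0 : ∀ i, t i = 0 := by
      intro i
      have : ∑ i, t i ^ 2 = 0 := by rw [← hvt, h0]; rfl
      have := (Finset.sum_eq_zero_iff_of_nonneg (fun i _ => sq_nonneg (t i))).1 this i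
        (Finset.mem_univ i)
      exact pow_eq_zero_iff (two_ne_zero) |>.1 this
    have hR : 0 ≤ R := (Real.sqrt_nonneg _).trans ht
    have : {g | s * R < |ip g t|} = ∅ := by
      ext g
      simp only [ip, ht0, mul_zero, Finset.sum_const_zero, abs_zero, Set.mem_ofPred_eq,
        Set.mem_empty_iff_false, iff_false, not_lt]
      positivity
    rw [this]; simp
  have hpos : 0 < (v : ℝ) := by positivity
  have hsub : HasSubgaussianMGF (fun g => ip g t) v (gaussianPi n) := by
    have hmap := map_ip_gaussianPi t
    refine ⟨fun r => ?_, fun r => ?_⟩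
    · have := integrable_exp_mul_gaussianReal (μ := 0) (v := v) r
      rw [hv, ← hmap] at this
      exact (integrable_map_measure (by fun_prop)
        (continuous_ip_left t).measurable.aemeasurable).1 this
    · rw [mgf_gaussianReal hmap]
      simp [hv]
  have hRv : s ^ 2 * v ≤ (s * R) ^ 2 := by
    rw [mul_pow, hvR]
    have : 0 ≤ enorm2 t := Real.sqrt_nonneg _
    gcongr
  have hexp : Real.exp (-(s * R) ^ 2 / (2 * v)) ≤ Real.exp (-s ^ 2 / 2) := by
    apply Real.exp_le_exp.2
    rw [div_le_div_iff₀ (by positivity) (by positivity)]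
    nlinarith
  have hR : 0 ≤ R := (Real.sqrt_nonneg _).trans ht
  have h1 := (hsub.measure_ge_le (ε := s * R) (by positivity)).trans hexp
  have h2 := (hsub.neg.measure_ge_le (ε := s * R) (by positivity)).trans hexp
  calc gaussianPi n {g | s * R < |ip g t|}
      ≤ gaussianPi n ({g | s * R ≤ ip g t} ∪ {g | s * R ≤ (-fun g => ip g t) g}) := by
        apply measure_mono
        intro g hg
        rcases lt_abs.1 (show s * R < |ip g t| from hg) with h | h
        · exact Or.inl h.le
        · exact Or.inr h.le
    _ ≤ _ := measure_union_le _ _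
    _ ≤ ENNReal.ofReal (Real.exp (-s ^ 2 / 2)) + ENNReal.ofReal (Real.exp (-s ^ 2 / 2)) := by
        gcongr
        · rw [← ofReal_measureReal]; exact ENNReal.ofReal_le_ofReal h1
        · rw [← ofReal_measureReal]; exact ENNReal.ofReal_le_ofReal h2
    _ = _ := by
        rw [← ENNReal.ofReal_add (by positivity) (by positivity), two_mul]

/-- The gaussian process `x ↦ sup_{t ∈ T} |⟨x, t⟩|`, whose mean is `meanWidth T`. -/
def supIp {n : ℕ} (T : Set (Fin n → ℝ)) (x : Fin n → ℝ) : ℝ := sSup ((fun t => |ip x t|) '' T)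

lemma abs_ip_le {n : ℕ} (x t : Fin n → ℝ) : |ip x t| ≤ enorm2 x * enorm2 t := by
  unfold ip enorm2
  rw [← Real.sqrt_mul (by positivity)]
  exact Real.abs_le_sqrt (Finset.sum_mul_sq_le_sq_mul_sq _ _ _)

lemma enorm2_nonneg {n : ℕ} (x : Fin n → ℝ) : 0 ≤ enorm2 x := Real.sqrt_nonneg _

lemma sSup_enorm2_nonneg {n : ℕ} (T : Set (Fin n → ℝ)) : 0 ≤ sSup (enorm2 '' T) := by
  refine Real.sSup_nonneg ?_
  rintro _ ⟨t, _, rfl⟩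
  exact enorm2_nonneg t

lemma ip_smul_left {n : ℕ} (a : ℝ) (x t : Fin n → ℝ) : ip (a • x) t = a * ip x t := by
  simp [ip, Finset.mul_sum, mul_assoc]

lemma ip_add_left {n : ℕ} (x y t : Fin n → ℝ) : ip (x + y) t = ip x t + ip y t := by
  simp [ip, add_mul, Finset.sum_add_distrib]

section

variable {n : ℕ} {T : Set (Fin n → ℝ)}

lemma enorm2_le_sSup (hT : BddAbove (enorm2 '' T)) {t : Fin n → ℝ} (ht : t ∈ T) :
    enorm2 t ≤ sSup (enorm2 '' T) :=
  le_csSup hT (Set.mem_image_of_mem _ ht)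

lemma abs_ip_le_mul_sSup (hT : BddAbove (enorm2 '' T)) (x : Fin n → ℝ) {t : Fin n → ℝ}
    (ht : t ∈ T) : |ip x t| ≤ enorm2 x * sSup (enorm2 '' T) :=
  (abs_ip_le x t).trans (mul_le_mul_of_nonneg_left (enorm2_le_sSup hT ht) (enorm2_nonneg x))

lemma bddAbove_abs_ip (hT : BddAbove (enorm2 '' T)) (x : Fin n → ℝ) :
    BddAbove ((fun t => |ip x t|) '' T) := by
  refine ⟨enorm2 x * sSup (enorm2 '' T), ?_⟩
  rintro _ ⟨t, ht, rfl⟩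
  exact abs_ip_le_mul_sSup hT x ht

lemma abs_ip_le_supIp (hT : BddAbove (enorm2 '' T)) (x : Fin n → ℝ) {t : Fin n → ℝ}
    (ht : t ∈ T) : |ip x t| ≤ supIp T x :=
  le_csSup (bddAbove_abs_ip hT x) ⟨t, ht, rfl⟩

lemma supIp_nonneg (x : Fin n → ℝ) : 0 ≤ supIp T x := by
  refine Real.sSup_nonneg ?_
  rintro _ ⟨t, _, rfl⟩
  exact abs_nonneg _

lemma exists_supIp_le_two_mul (hne : T.Nonempty) (x : Fin n → ℝ) :
    ∃ t ∈ T, supIp T x ≤ 2 * |ip x t| := by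
  rcases (supIp_nonneg (T := T) x).eq_or_lt with h | h
  · obtain ⟨t, ht⟩ := hne
    exact ⟨t, ht, by rw [← h]; positivity⟩
  · obtain ⟨_, ⟨t, ht, rfl⟩, hlt⟩ :=
      exists_lt_of_lt_csSup (hne.image (fun t => |ip x t|)) (half_lt_self h)
    exact ⟨t, ht, by dsimp only at hlt; unfold supIp; linarith⟩

lemma measurable_supIp (hT : BddAbove (enorm2 '' T)) : Measurable (supIp T) := by
  have h : supIp T = fun x => ⨆ t : T, |ip x t| := by
    ext x; rw [supIp, sSup_image']
  rw [h]
  refine LowerSemicontinuous.measurable (lowerSemicontinuous_ciSup (fun x => ?_) fun t => ?_)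
  · have := bddAbove_abs_ip hT x
    rwa [Set.image_eq_range] at this
  · exact (continuous_ip_left (t : Fin n → ℝ)).abs.lowerSemicontinuous

lemma integrable_supIp (hT : BddAbove (enorm2 '' T)) :
    Integrable (supIp T) (gaussianPi n) := by
  have hR := sSup_enorm2_nonneg T
  have hint : Integrable (fun x : Fin n → ℝ => (∑ i, |x i|) * sSup (enorm2 '' T))
      (gaussianPi n) := by
    refine (integrable_finsetSum _ fun i _ => ?_).mul_const _
    refine Integrable.abs ?_
    have : Integrable (id : ℝ → ℝ) (gaussianReal 0 1) :=
      (memLp_id_gaussianReal 1).integrable (by norm_num)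
    exact integrable_comp_eval (μ := fun _ : Fin n => gaussianReal 0 1) (i := i) this
  refine hint.mono' (measurable_supIp hT).aestronglyMeasurable (.of_forall fun x => ?_)
  rw [Real.norm_of_nonneg (supIp_nonneg x)]
  refine Real.sSup_le ?_ (by positivity)
  rintro _ ⟨t, ht, rfl⟩
  refine (abs_ip_le_mul_sSup hT x ht).trans (mul_le_mul_of_nonneg_right ?_ hR)
  rw [enorm2, Real.sqrt_le_left (by positivity)]
  calc ∑ i, x i ^ 2 = ∑ i, |x i| ^ 2 := by simp
    _ ≤ _ := Finset.sum_sq_le_sq_sum_of_nonneg fun _ _ => abs_nonneg _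

lemma prod_gaussianPi_supIp_le (hne : T.Nonempty) (hT : BddAbove (enorm2 '' T)) {σ s : ℝ}
    (hσ : |σ| = 1) (hs : 0 ≤ s) :
    ((gaussianPi n).prod (gaussianPi n))
      {p | 2 * √2 * supIp T ((√2)⁻¹ • (p.1 + σ • p.2)) + 2 * (s * sSup (enorm2 '' T))
        < supIp T p.1} ≤ ENNReal.ofReal (2 * Real.exp (-s ^ 2 / 2)) := by
  have hm := measurable_supIp hT
  rw [Measure.prod_apply (measurableSet_lt (by fun_prop) (by fun_prop))]
  refine (lintegral_mono (g := fun _ => ENNReal.ofReal (2 * Real.exp (-s ^ 2 / 2)))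
    fun x => ?_).trans (by simp)
  obtain ⟨t, ht, hxt⟩ := exists_supIp_le_two_mul hne x
  refine (measure_mono fun y hy => ?_).trans
    (gaussianPi_abs_ip_gt_le t (enorm2_le_sSup hT ht) hs)
  change 2 * √2 * supIp T ((√2)⁻¹ • (x + σ • y)) + 2 * (s * sSup (enorm2 '' T)) < supIp T x at hy
  change s * sSup (enorm2 '' T) < |ip y t|
  have h1 := abs_ip_le_supIp hT ((√2)⁻¹ • (x + σ • y)) ht
  rw [ip_smul_left, ip_add_left, ip_smul_left, abs_mul, abs_of_pos (by positivity)] at h1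
  have h2 : √2 * ((√2)⁻¹ * |ip x t + σ * ip y t|) ≤
      √2 * supIp T ((√2)⁻¹ • (x + σ • y)) := mul_le_mul_of_nonneg_left h1 (by positivity)
  rw [mul_inv_cancel_left₀ (by positivity)] at h2
  have h3 : |ip x t| ≤ |ip x t + σ * ip y t| + |ip y t| := by
    have := abs_sub (ip x t + σ * ip y t) (σ * ip y t)
    rw [add_sub_cancel_right, abs_mul, hσ, one_mul] at this
    exact this
  linarith

lemma prod_gaussianPi_supIp_sub_le (hne : T.Nonempty) (hT : BddAbove (enorm2 '' T)) {s : ℝ}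
    (hs : 0 ≤ s) :
    ((gaussianPi n).prod (gaussianPi n))
      {p | 8 * supIp T p.2 + 8 * (s * sSup (enorm2 '' T)) < supIp T p.1} ≤
      ENNReal.ofReal (4 * Real.exp (-s ^ 2 / 2)) := by
  have hm := measurable_supIp hT
  have hR := sSup_enorm2_nonneg T
  have h1 := prod_gaussianPi_supIp_le hne hT (σ := 1) (by simp) hs
  have h2 := prod_gaussianPi_supIp_le hne hT (σ := -1) (by simp) hs
  rw [← map_add_sub_gaussianPi, Measure.map_apply (by fun_prop)
    (measurableSet_lt (by fun_prop) (by fun_prop))] at h2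
  have h4 : ENNReal.ofReal (4 * Real.exp (-s ^ 2 / 2)) =
      ENNReal.ofReal (2 * Real.exp (-s ^ 2 / 2)) + ENNReal.ofReal (2 * Real.exp (-s ^ 2 / 2)) := by
    rw [← ENNReal.ofReal_add (by positivity) (by positivity)]
    ring_nf
  rw [h4]
  refine le_trans (measure_mono ?_) ((measure_union_le _ _).trans (add_le_add h1 h2))
  rintro ⟨x, y⟩ hxy
  change 8 * supIp T y + 8 * (s * sSup (enorm2 '' T)) < supIp T x at hxy
  by_contra hcon
  rw [Set.mem_union, not_or] at hcon
  obtain ⟨hc1, hc2⟩ := hcon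
  replace hc1 : supIp T x ≤ 2 * √2 * supIp T ((√2)⁻¹ • (x + (1 : ℝ) • y)) +
    2 * (s * sSup (enorm2 '' T)) := not_lt.1 hc1
  replace hc2 : supIp T ((√2)⁻¹ • (x + y)) ≤
    2 * √2 * supIp T ((√2)⁻¹ • ((√2)⁻¹ • (x + y) + (-1 : ℝ) • (√2)⁻¹ • (x - y))) +
    2 * (s * sSup (enorm2 '' T)) := not_lt.1 hc2
  have hsq : √2 * √2 = 2 := Real.mul_self_sqrt (by norm_num)
  have hy : (√2)⁻¹ • ((√2)⁻¹ • (x + y) + (-1 : ℝ) • (√2)⁻¹ • (x - y)) = y := by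
    have : (√2)⁻¹ * (√2)⁻¹ = 1 / 2 := by rw [← mul_inv, hsq]; norm_num
    ext i
    simp only [Pi.smul_apply, Pi.add_apply, Pi.sub_apply, smul_eq_mul]
    linear_combination 2 * y i * this
  simp only [hy, one_smul] at hc1 hc2
  have hlt : √2 ≤ 3 / 2 := by rw [Real.sqrt_le_left (by norm_num)]; norm_num
  have hsR : 0 ≤ s * sSup (enorm2 '' T) := by positivity
  have h5 := mul_le_mul_of_nonneg_left hc2 (show 0 ≤ 2 * √2 by positivity)
  have h6 := mul_le_mul_of_nonneg_right hlt hsR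
  have h7 : 2 * √2 * (2 * √2 * supIp T y) = 8 * supIp T y := by
    linear_combination 4 * supIp T y * hsq
  nlinarith

lemma half_le_gaussianPi_supIp_le (hT : BddAbove (enorm2 '' T)) :
    1 / 2 ≤ gaussianPi n {y | supIp T y ≤ 2 * meanWidth T} := by
  have hm := measurable_supIp hT
  have hint := integrable_supIp hT
  have hnn : 0 ≤ᵐ[gaussianPi n] supIp T := .of_forall fun x => supIp_nonneg x
  have hE : meanWidth T = ∫ x, supIp T x ∂gaussianPi n := rfl
  have h0 : 0 ≤ meanWidth T := integral_nonneg fun x => supIp_nonneg x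
  rcases h0.eq_or_lt with h | h
  · rw [hE, eq_comm, integral_eq_zero_iff_of_nonneg_ae hnn hint] at h
    have : gaussianPi n {y | supIp T y ≤ 2 * meanWidth T} = 1 := by
      rw [prob_compl_eq_zero_iff (measurableSet_le hm measurable_const) |>.symm]
      refine measure_mono_null (fun y hy => ?_) (ae_iff.1 h)
      change ¬ (supIp T y = 0)
      intro h'
      exact hy (show supIp T y ≤ _ by rw [h']; positivity)
    rw [this]
    exact ENNReal.half_le_self
  · have hmk := mul_meas_ge_le_integral_of_nonneg hnn hint (2 * meanWidth T)
    have hle : (gaussianPi n).real {y | supIp T y ≤ 2 * meanWidth T}ᶜ ≤ 1 / 2 := by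
      refine (measureReal_mono (s₂ := {y | 2 * meanWidth T ≤ supIp T y})
        (fun y hy => (not_le.1 (show ¬ supIp T y ≤ 2 * meanWidth T from hy)).le)).trans ?_
      rw [← hE] at hmk
      nlinarith
    rw [probReal_compl_eq_one_sub (measurableSet_le hm measurable_const)] at hle
    rw [← ofReal_measureReal, show (1 / 2 : ENNReal) = ENNReal.ofReal (1 / 2) by
      rw [ENNReal.ofReal_div_of_pos (by norm_num)]; simp]
    exact ENNReal.ofReal_le_ofReal (by linarith)

/-- Gaussian concentration, up to constants: the supremum of a gaussian process rarely exceeds a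
multiple of its mean by more than a multiple of the radius of the index set. -/
lemma gaussianPi_supIp_gt_le (hne : T.Nonempty) (hT : BddAbove (enorm2 '' T)) {s : ℝ}
    (hs : 0 ≤ s) :
    gaussianPi n {x | 16 * meanWidth T + 8 * (s * sSup (enorm2 '' T)) < supIp T x} ≤
      ENNReal.ofReal (8 * Real.exp (-s ^ 2 / 2)) := by
  set A := {x | 16 * meanWidth T + 8 * (s * sSup (enorm2 '' T)) < supIp T x}
  set B := {y | supIp T y ≤ 2 * meanWidth T}
  have h1 : gaussianPi n A * gaussianPi n B ≤ ENNReal.ofReal (4 * Real.exp (-s ^ 2 / 2)) := by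
    rw [← Measure.prod_prod]
    refine (measure_mono ?_).trans (prod_gaussianPi_supIp_sub_le hne hT hs)
    rintro ⟨x, y⟩ ⟨hx, hy⟩
    change 8 * supIp T y + 8 * (s * sSup (enorm2 '' T)) < supIp T x
    change 16 * meanWidth T + 8 * (s * sSup (enorm2 '' T)) < supIp T x at hx
    change supIp T y ≤ 2 * meanWidth T at hy
    linarith
  calc gaussianPi n A = 2 * (gaussianPi n A * (1 / 2)) := by
        rw [mul_comm, mul_assoc, one_div, ENNReal.inv_mul_cancel (by simp) (by simp), mul_one]
    _ ≤ 2 * (gaussianPi n A * gaussianPi n B) := by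
        gcongr
        exact half_le_gaussianPi_supIp_le hT
    _ ≤ 2 * ENNReal.ofReal (4 * Real.exp (-s ^ 2 / 2)) := by gcongr
    _ = _ := by
        rw [show (2 : ENNReal) = ENNReal.ofReal 2 by simp, ← ENNReal.ofReal_mul (by norm_num)]
        ring_nf

end

lemma exists_maximal_separated_sphere (E : Type*) [NormedAddCommGroup E] [NormedSpace ℝ E]
    [FiniteDimensional ℝ E] :
    ∃ s : Finset E, s.card ≤ 5 ^ Module.finrank ℝ E ∧ (∀ c ∈ s, ‖c‖ = 2) ∧
      ∀ w : E, ‖w‖ = 2 → ∃ c ∈ s, ‖w - c‖ < 1 := by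
  classical
  let P : Finset E → Prop := fun s =>
    (∀ c ∈ s, ‖c‖ = 2) ∧ ∀ c ∈ s, ∀ d ∈ s, c ≠ d → 1 ≤ ‖c - d‖
  have hcard : ∀ s, P s → s.card ≤ 5 ^ Module.finrank ℝ E := fun s hs =>
    Besicovitch.card_le_of_separated s (fun c hc => (hs.1 c hc).le) hs.2
  let S : Set ℕ := {k | ∃ s, P s ∧ s.card = k}
  have hbdd : BddAbove S := ⟨5 ^ Module.finrank ℝ E, by rintro _ ⟨s, hs, rfl⟩; exact hcard s hs⟩
  obtain ⟨s, hs, hsk⟩ := Nat.sSup_mem (s := S) ⟨0, ∅, ⟨by simp, by simp⟩, rfl⟩ hbdd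
  refine ⟨s, hcard s hs, hs.1, fun w hw => ?_⟩
  by_contra! hcon
  have hws : w ∉ s := fun h => by
    have := hcon w h
    rw [sub_self, norm_zero] at this
    linarith
  have hP : P (insert w s) := by
    refine ⟨fun c hc => ?_, fun c hc d hd hcd => ?_⟩
    · rcases Finset.mem_insert.1 hc with rfl | hc
      exacts [hw, hs.1 c hc]
    · rcases Finset.mem_insert.1 hc with rfl | hc' <;> rcases Finset.mem_insert.1 hd with rfl | hd'
      · exact absurd rfl hcd
      · exact hcon d hd'
      · rw [norm_sub_rev]; exact hcon c hc'
      · exact hs.2 c hc' d hd' hcd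
  have h1 := le_csSup hbdd (show (insert w s).card ∈ S from ⟨_, hP, rfl⟩)
  rw [Finset.card_insert_of_notMem hws] at h1
  omega

lemma exists_norming_finset (E : Type*) [NormedAddCommGroup E] [InnerProductSpace ℝ E]
    [FiniteDimensional ℝ E] :
    ∃ N : Finset E, N.card ≤ 5 ^ Module.finrank ℝ E ∧ (∀ y ∈ N, ‖y‖ = 1) ∧
      ∀ (v : E) (b : ℝ), 0 ≤ b → (∀ y ∈ N, |inner ℝ v y| ≤ b) → ‖v‖ ≤ 2 * b := by
  classical
  obtain ⟨s, hcard, hnorm, hs⟩ := exists_maximal_separated_sphere E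
  refine ⟨s.image ((2 : ℝ)⁻¹ • ·), Finset.card_image_le.trans hcard, ?_, ?_⟩
  · simp only [Finset.mem_image]
    rintro _ ⟨c, hc, rfl⟩
    rw [norm_smul, hnorm c hc]
    norm_num
  · intro v b hb hv
    rcases eq_or_ne v 0 with rfl | h0
    · simpa using hb
    have hpos : 0 < ‖v‖ := norm_pos_iff.2 h0
    obtain ⟨c, hc, hlt⟩ := hs ((2 / ‖v‖) • v) (by
      rw [norm_smul, Real.norm_of_nonneg (by positivity)]; field_simp)
    have h1 := hv _ (Finset.mem_image_of_mem _ hc)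
    rw [inner_smul_right] at h1
    have h2 : inner ℝ v ((2 / ‖v‖) • v - c) ≤ ‖v‖ * 1 :=
      (real_inner_le_norm _ _).trans (by gcongr)
    rw [inner_sub_right, inner_smul_right, real_inner_self_eq_norm_sq] at h2
    have h3 : 2 / ‖v‖ * ‖v‖ ^ 2 = 2 * ‖v‖ := by field_simp
    have h4 := (le_abs_self _).trans h1
    linarith

lemma exists_norming_finset_coords {m : ℕ} (I : Finset (Fin m)) :
    ∃ N : Finset (Fin m → ℝ), N.card ≤ 5 ^ I.card ∧ (∀ y ∈ N, ∑ i, y i ^ 2 = 1) ∧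
      ∀ (v : Fin m → ℝ) (b : ℝ), 0 ≤ b → (∀ y ∈ N, |ip v y| ≤ b) →
        √(∑ i ∈ I, v i ^ 2) ≤ 2 * b := by
  classical
  obtain ⟨N, hcard, hnorm, hN⟩ := exists_norming_finset (EuclideanSpace ℝ I)
  let ext : EuclideanSpace ℝ I → Fin m → ℝ := fun y i => if h : i ∈ I then y ⟨i, h⟩ else 0
  have hext : ∀ (y : EuclideanSpace ℝ I) (i : I), ext y i = y i := fun y i => by simp [ext]
  have hzero : ∀ (y : EuclideanSpace ℝ I) (i : Fin m), i ∉ I → ext y i = 0 := fun y i hi => by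
    simp [ext, hi]
  refine ⟨N.image ext, Finset.card_image_le.trans (by simpa using hcard), ?_, ?_⟩
  · simp only [Finset.mem_image]
    rintro _ ⟨y, hy, rfl⟩
    have h := EuclideanSpace.norm_sq_eq y
    rw [hnorm y hy] at h
    rw [← Finset.sum_subset (Finset.subset_univ I) fun i _ hi => by simp [hzero y i hi],
      ← Finset.sum_coe_sort]
    simp only [hext]
    simpa using h.symm
  · intro v b hb hv
    have h := hN (WithLp.toLp 2 fun i : I => v i) b hb fun y hy => ?_
    · rw [EuclideanSpace.norm_eq] at h
      simp only [Real.norm_eq_abs, sq_abs] at h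
      rwa [Finset.sum_coe_sort I (fun i => v i ^ 2)] at h
    · have h1 := hv _ (Finset.mem_image_of_mem _ hy)
      rw [ip, ← Finset.sum_subset (Finset.subset_univ I) fun i _ hi => by simp [hzero y i hi],
        ← Finset.sum_coe_sort] at h1
      simpa only [hext, PiLp.inner_apply, RCLike.inner_apply, conj_trivial, mul_comm] using h1

lemma ip_mulVecR {m n : ℕ} (A : Fin m → Fin n → ℝ) (t : Fin n → ℝ) (y : Fin m → ℝ) :
    ip (mulVecR A t) y = ip (∑ i, y i • A i) t := by
  simp only [ip, mulVecR, Finset.sum_apply, Pi.smul_apply, smul_eq_mul, Finset.sum_mul]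
  rw [Finset.sum_comm]
  exact Finset.sum_congr rfl fun _ _ => Finset.sum_congr rfl fun _ _ => by ring

lemma gaussianMatrix_supIp_gt_le {m n : ℕ} {T : Set (Fin n → ℝ)} (hne : T.Nonempty)
    (hT : BddAbove (enorm2 '' T)) {s : ℝ} (hs : 0 ≤ s) {y : Fin m → ℝ} (hy : ∑ i, y i ^ 2 = 1) :
    gaussianMatrix m n {A | 16 * meanWidth T + 8 * (s * sSup (enorm2 '' T)) <
      supIp T (∑ i, y i • A i)} ≤ ENNReal.ofReal (8 * Real.exp (-s ^ 2 / 2)) := by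
  have h := gaussianPi_supIp_gt_le hne hT hs
  rwa [← map_vecMul_gaussianMatrix y hy, Measure.map_apply (by fun_prop)
    (measurableSet_lt measurable_const (measurable_supIp hT))] at h

lemma choose_le_exp_mul_log {m k : ℕ} (hk : 1 ≤ k) (hkm : k ≤ m) :
    (m.choose k : ℝ) ≤ Real.exp (k * Real.log (Real.exp 1 * m / k)) := by
  have hk0 : (0 : ℝ) < k := by exact_mod_cast hk
  have hm0 : (0 : ℝ) < m := by exact_mod_cast hk.trans hkm
  rw [mul_comm, Real.exp_mul, Real.exp_log (by positivity), Real.rpow_natCast, div_pow, mul_pow,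
    ← Real.exp_nat_mul, mul_one, le_div_iff₀ (by positivity)]
  have h1 := Nat.choose_le_pow_div (α := ℝ) k m
  have h2 := Real.pow_div_factorial_le_exp (x := k) hk0.le k
  calc (m.choose k : ℝ) * k ^ k ≤ (m ^ k / k.factorial) * k ^ k := by gcongr
    _ = (k ^ k / k.factorial) * m ^ k := by ring
    _ ≤ _ := by gcongr

lemma one_le_log_exp_mul_div {m k : ℕ} (hk : 1 ≤ k) (hkm : k ≤ m) :
    1 ≤ Real.log (Real.exp 1 * m / k) := by
  have hk0 : (0 : ℝ) < k := by exact_mod_cast hk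
  have hkm' : (k : ℝ) ≤ m := by exact_mod_cast hkm
  have hm0 : (0 : ℝ) < m := hk0.trans_le hkm'
  rw [Real.le_log_iff_exp_le (by positivity), le_div_iff₀ hk0]
  gcongr

lemma choose_mul_five_pow_mul_exp_le {m k : ℕ} (hk : 1 ≤ k) (hkm : k ≤ m) {u : ℝ} (hu : 1 ≤ u) :
    m.choose k * (5 ^ k *
      (8 * Real.exp (-(4 * u * √(k * Real.log (Real.exp 1 * m / k))) ^ 2 / 2))) ≤
      2 * Real.exp (-1 * u ^ 2 * k * Real.log (Real.exp 1 * m / k)) := by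
  have hL := one_le_log_exp_mul_div hk hkm
  have hchoose := choose_le_exp_mul_log hk hkm
  set L := Real.log (Real.exp 1 * m / k)
  have hk1 : (1 : ℝ) ≤ k := by exact_mod_cast hk
  have h5 : (5 : ℝ) ≤ Real.exp 2 := by
    have : Real.exp 2 = Real.exp 1 * Real.exp 1 := by rw [← Real.exp_add]; norm_num
    nlinarith [Real.exp_one_gt_d9]
  have h5k : (5 : ℝ) ^ k ≤ Real.exp (2 * k) := by
    rw [mul_comm, Real.exp_nat_mul]
    gcongr
  have h4 : (8 : ℝ) ≤ 2 * Real.exp (2 * k) := by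
    have : Real.exp 2 ≤ Real.exp (2 * k) := Real.exp_le_exp.2 (by linarith)
    linarith
  have hkL : (k : ℝ) ≤ k * L := le_mul_of_one_le_right (by positivity) hL
  have hu2 : k * L ≤ u ^ 2 * (k * L) :=
    le_mul_of_one_le_left (by positivity) (one_le_pow₀ hu)
  rw [mul_pow, Real.sq_sqrt (by positivity)]
  calc _ ≤ Real.exp (k * L) * (Real.exp (2 * k) *
        (2 * Real.exp (2 * k) * Real.exp (-((4 * u) ^ 2 * (k * L)) / 2))) := by gcongr
    _ = 2 * Real.exp (k * L + (2 * k + (2 * k + -((4 * u) ^ 2 * (k * L)) / 2))) := by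
        simp only [Real.exp_add]; ring
    _ ≤ _ := by
        gcongr
        nlinarith

/-- Theorem 2.5: a gaussian matrix maps T to well-spread vectors. -/
theorem gaussian_good_position :
    ∃ c C : ℝ, 0 < c ∧ 0 < C ∧
      ∀ (n m : ℕ) (T : Set (Fin n → ℝ)) (u : ℝ) (k : ℕ),
        T.Nonempty → BddAbove (enorm2 '' T) → 1 ≤ u → 1 ≤ k → k ≤ m →
        ENNReal.ofReal (1 - 2 * Real.exp (-c * u^2 * k * Real.log (Real.exp 1 * m / k))) ≤
          gaussianMatrix m n
            {A | ∀ t ∈ T, knorm k (mulVecR A t) ≤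
              C * (meanWidth T
                + u * sSup (enorm2 '' T) * Real.sqrt (k * Real.log (Real.exp 1 * m / k)))} := by
  refine ⟨1, 64, one_pos, by norm_num, fun n m T u k hne hT hu hk hkm => ?_⟩
  set L := Real.log (Real.exp 1 * m / k)
  set R := sSup (enorm2 '' T)
  have hR : 0 ≤ R := sSup_enorm2_nonneg T
  have hW : 0 ≤ meanWidth T := integral_nonneg fun x => supIp_nonneg x
  set s : ℝ := 4 * u * √(k * L) with hs
  have hs0 : 0 ≤ s := by positivity
  choose N hcard hnorm hN using fun I : Finset (Fin m) => exists_norming_finset_coords I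
  let bad : (Fin m → ℝ) → Set (Fin m → Fin n → ℝ) := fun y =>
    {A | 16 * meanWidth T + 8 * (s * R) < supIp T (∑ i, y i • A i)}
  have hbad : gaussianMatrix m n (⋃ I ∈ Finset.powersetCard k Finset.univ, ⋃ y ∈ N I, bad y) ≤
      ENNReal.ofReal (2 * Real.exp (-1 * u ^ 2 * k * L)) := by
    calc _ ≤ ∑ I ∈ Finset.powersetCard k (Finset.univ : Finset (Fin m)),
          ∑ y ∈ N I, gaussianMatrix m n (bad y) :=
          (measure_biUnion_finset_le _ _).trans
            (Finset.sum_le_sum fun I _ => measure_biUnion_finset_le _ _)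
      _ ≤ ∑ I ∈ Finset.powersetCard k (Finset.univ : Finset (Fin m)),
          ENNReal.ofReal (5 ^ k * (8 * Real.exp (-s ^ 2 / 2))) := by
          refine Finset.sum_le_sum fun I hI => ?_
          refine (Finset.sum_le_card_nsmul _ _ _ fun y hy =>
            gaussianMatrix_supIp_gt_le hne hT hs0 (hnorm I y hy)).trans ?_
          rw [nsmul_eq_mul, ← ENNReal.ofReal_natCast, ← ENNReal.ofReal_mul (by positivity)]
          refine ENNReal.ofReal_le_ofReal ?_
          gcongr
          have := hcard I
          rw [(Finset.mem_powersetCard.1 hI).2] at this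
          exact_mod_cast this
      _ = ENNReal.ofReal (m.choose k * (5 ^ k * (8 * Real.exp (-s ^ 2 / 2)))) := by
          rw [Finset.sum_const, Finset.card_powersetCard, Finset.card_univ, Fintype.card_fin,
            nsmul_eq_mul, ← ENNReal.ofReal_natCast, ← ENNReal.ofReal_mul (by positivity)]
      _ ≤ _ := ENNReal.ofReal_le_ofReal (choose_mul_five_pow_mul_exp_le hk hkm hu)
  set good := {A : Fin m → Fin n → ℝ | ∀ t ∈ T, knorm k (mulVecR A t) ≤
    64 * (meanWidth T + u * R * √(k * L))}
  have hsub : goodᶜ ⊆ ⋃ I ∈ Finset.powersetCard k Finset.univ, ⋃ y ∈ N I, bad y := by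
    intro A hA
    by_contra hcon
    refine hA fun t ht => ?_
    refine Real.sSup_le ?_ (by positivity)
    rintro _ ⟨I, hI, rfl⟩
    refine (hN I (mulVecR A t) (16 * meanWidth T + 8 * (s * R)) (by positivity)
      fun y hy => ?_).trans ?_
    · rw [ip_mulVecR]
      refine (abs_ip_le_supIp hT _ ht).trans (not_lt.1 fun hlt => hcon ?_)
      simp only [Set.mem_iUnion]
      exact ⟨I, Finset.mem_powersetCard.2 ⟨Finset.subset_univ I, hI⟩, y, hy, hlt⟩
    · rw [hs]
      linarith
  have huniv : 1 ≤ gaussianMatrix m n good + gaussianMatrix m n goodᶜ := by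
    rw [← measure_univ (μ := gaussianMatrix m n), ← Set.union_compl_self good]
    exact measure_union_le _ _
  rw [ENNReal.ofReal_sub _ (by positivity), ENNReal.ofReal_one, tsub_le_iff_right]
  exact huniv.trans (add_le_add le_rfl ((measure_mono hsub).trans hbad))

end
end

section
/- Let δ > 0, let T′ ⊆ ℝ^n, let V₁, …, V_s ⊆ ℝ^n, and let f : ℝ^n → {−1,1}^m, φ : {−1,1}^m × {−1,1}^m → ℝ. Assume: (i) for every pair of distinct t₁, t₂ ∈ T′ there exist 1 ≤ j ≤ s and v ∈ V_j with |⟨v, t₁−t₂⟩| ≥ δ; and (ii) for every t ∈ T′ and every 1 ≤ j ≤ s, (f,φ) is a (δ/4)-inner product-preserving embedding of V_j ∪ {t}, i.e., sup_{(x,y) ∈ (V_j∪{t})×(V_j∪{t})} |φ(f(x),f(y)) − ⟨x,y⟩| ≤ δ/4. Then f is injective on T′. -/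
open Real

noncomputable section

/-- Lemma 3.4: if the sets V_j separate the pairs of T′ and (f,φ) is a (δ/4)-inner
product-preserving embedding of each V_j ∪ {t}, then f is injective on T′. -/
theorem embedding_injective_on (n m s : ℕ) (δ : ℝ) (hδ : 0 < δ)
    (T' : Set (Fin n → ℝ)) (V : Fin s → Set (Fin n → ℝ))
    (f : (Fin n → ℝ) → Fin m → Bool)
    (φ : (Fin m → Bool) → (Fin m → Bool) → ℝ)
    (hsep : ∀ t₁ ∈ T', ∀ t₂ ∈ T', t₁ ≠ t₂ →
      ∃ j : Fin s, ∃ v ∈ V j, |ip v (t₁ - t₂)| ≥ δ)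
    (hemb : ∀ t ∈ T', ∀ j : Fin s,
      ∀ x ∈ V j ∪ {t}, ∀ y ∈ V j ∪ {t}, |φ (f x) (f y) - ip x y| ≤ δ / 4) :
    Set.InjOn f T' := by
  intro t₁ h₁ t₂ h₂ heq
  by_contra hne
  obtain ⟨j, v, hv, hsep_v⟩ := hsep t₁ h₁ t₂ h₂ hne
  have hφ₁ := hemb t₁ h₁ j v (Or.inl hv) t₁ (Or.inr rfl)
  have hφ₂ := hemb t₂ h₂ j v (Or.inl hv) t₂ (Or.inr rfl)
  have hsub : ip v (t₁ - t₂) = ip v t₁ - ip v t₂ := by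
    simp [ip, mul_sub]
  rw [heq] at hφ₁
  rw [hsub] at hsep_v
  rw [abs_le] at hφ₁ hφ₂
  have hle : |ip v t₁ - ip v t₂| ≤ δ / 2 := by
    rw [abs_le]
    constructor <;> linarith
  linarith

end
end

section
/- There are absolute constants c0, c1 > 0 such that the following holds. Let λ > 0 and let τ = (τ₁,…,τ_m) be uniformly distributed in [−λ,λ]^m. Then for any integer k ≤ m/2, with probability at least 1 − c0·exp(−c1·k), there is a permutation π of {1,…,m} such that for every integer i with k/2 ≤ i ≤ k, |τ_{π(i)}|/λ ≤ 2i/m. -/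
open MeasureTheory ProbabilityTheory Real

noncomputable section

/-- The uniform distribution on the interval `[-lam, lam]`. -/
def unifInterval (lam : ℝ) : Measure ℝ :=
  (ENNReal.ofReal (2 * lam))⁻¹ • volume.restrict (Set.Icc (-lam) lam)

lemma isProbabilityMeasure_unifInterval {lam : ℝ} (hlam : 0 < lam) :
    IsProbabilityMeasure (unifInterval lam) := by
  constructor
  have h : lam - -lam = 2 * lam := by ring
  simp only [unifInterval, Measure.smul_apply, Measure.restrict_apply_univ, Real.volume_Icc, h,
    smul_eq_mul]
  exact ENNReal.inv_mul_cancel (by simpa using hlam) ENNReal.ofReal_ne_top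

lemma unifCube_eq_pi (m : ℕ) {lam : ℝ} (hlam : 0 < lam) :
    unifCube m lam = Measure.pi fun _ : Fin m => unifInterval lam := by
  have := isProbabilityMeasure_unifInterval hlam
  symm
  refine Measure.pi_eq fun s hs => ?_
  rw [unifCube, volume_pi, Measure.restrict_pi_pi]
  simp only [unifInterval, Measure.smul_apply, Measure.pi_pi, smul_eq_mul,
    Finset.prod_mul_distrib, Finset.prod_const, Finset.card_univ, Fintype.card_fin]
  rw [ENNReal.ofReal_pow (by positivity), ENNReal.inv_pow]

lemma unifInterval_real_abs_div_le {lam p : ℝ} (hlam : 0 < lam) (hp0 : 0 ≤ p) (hp1 : p ≤ 1) :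
    (unifInterval lam).real {x | |x| / lam ≤ p} = p := by
  have hset : {x : ℝ | |x| / lam ≤ p} = Set.Icc (-(p * lam)) (p * lam) := by
    ext x
    simp [div_le_iff₀ hlam, abs_le]
  have hsub : Set.Icc (-(p * lam)) (p * lam) ⊆ Set.Icc (-lam) lam :=
    Set.Icc_subset_Icc (by nlinarith) (by nlinarith)
  rw [hset, unifInterval, measureReal_ennreal_smul_apply, measureReal_def,
    Measure.restrict_apply measurableSet_Icc, Set.inter_eq_left.mpr hsub, Real.volume_Icc,
    ENNReal.toReal_inv, ENNReal.toReal_ofReal (by positivity),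
    ENNReal.toReal_ofReal (by nlinarith)]
  field_simp
  ring

open Classical in
/-- A Chernoff bound for the lower tail of the number of independent samples landing in `A`. -/
lemma measureReal_pi_card_lt_le {α ι : Type*} [MeasurableSpace α] [Fintype ι] (ν : Measure α)
    [IsProbabilityMeasure ν] {A : Set α} (hA : MeasurableSet A) (n : ℕ) :
    (Measure.pi fun _ : ι => ν).real {τ | (Finset.univ.filter fun j => τ j ∈ A).card < n} ≤
      2 ^ n * exp (-(ν.real A * Fintype.card ι / 2)) := by
  set g : α → ℝ := fun x => A.indicator (fun _ => -(1 / 2)) x + 1 with hg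
  have hind : Integrable (A.indicator fun _ => (-(1 / 2) : ℝ)) ν :=
    (integrable_const _).indicator hA
  have hgint : Integrable g ν := hind.add (integrable_const _)
  have hg_integral : ∫ x, g x ∂ν = 1 - ν.real A / 2 := by
    rw [hg, integral_add hind (integrable_const _), integral_indicator_const _ hA]
    simp
    ring
  have hprod (τ : ι → α) :
      ∏ j, g (τ j) = (1 / 2) ^ (Finset.univ.filter fun j => τ j ∈ A).card := by
    have h (x : α) : g x = if x ∈ A then 1 / 2 else 1 := by
      by_cases hx : x ∈ A <;> simp [hg, hx]
      norm_num
    simp_rw [h]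
    rw [Finset.prod_ite]
    simp
  have hmarkov := mul_meas_ge_le_integral_of_nonneg (μ := Measure.pi fun _ : ι => ν)
    (f := fun τ => ∏ j, g (τ j)) (Filter.Eventually.of_forall fun τ => by
      simp only [hprod]; positivity)
    (Integrable.fintype_prod fun _ => hgint) ((1 / 2) ^ n)
  rw [integral_fintype_prod_eq_prod, Finset.prod_const, Finset.card_univ, hg_integral] at hmarkov
  have hmono : (Measure.pi fun _ : ι => ν).real
      {τ | (Finset.univ.filter fun j => τ j ∈ A).card < n} ≤
      (Measure.pi fun _ : ι => ν).real {τ | (1 / 2) ^ n ≤ ∏ j, g (τ j)} := by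
    refine measureReal_mono fun τ hτ => ?_
    simp only [Set.mem_ofPred_eq, hprod] at hτ ⊢
    exact pow_le_pow_of_le_one (by norm_num) (by norm_num) hτ.le
  have hexp : (1 - ν.real A / 2) ^ Fintype.card ι ≤
      exp (-(ν.real A * Fintype.card ι / 2)) := by
    have hle : ν.real A ≤ 1 := measureReal_le_one
    calc (1 - ν.real A / 2) ^ Fintype.card ι ≤ exp (-(ν.real A / 2)) ^ Fintype.card ι :=
          pow_le_pow_left₀ (by linarith) (one_sub_le_exp_neg _) _
      _ = _ := by rw [← exp_nat_mul]; ring_nf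
  calc _ ≤ _ := hmono
    _ = 2 ^ n * ((1 / 2) ^ n *
        (Measure.pi fun _ : ι => ν).real {τ | (1 / 2) ^ n ≤ ∏ j, g (τ j)}) := by
        rw [← mul_assoc, ← mul_pow]; norm_num
    _ ≤ _ := by gcongr; exact hmarkov.trans hexp

/-- If `f` takes more than `i` values at most `c`, the `i`-th smallest value is at most `c`. -/
lemma apply_sort_le_of_lt_card {m : ℕ} (f : Fin m → ℝ) (c : ℝ) (i : Fin m)
    (h : (i : ℕ) < (Finset.univ.filter fun j => f j ≤ c).card) : f (Tuple.sort f i) ≤ c := by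
  by_contra! hc
  have hcard : (Finset.univ.filter fun j => f j ≤ c).card ≤ (Finset.Iio i).card := by
    refine Finset.card_le_card_of_injOn (Tuple.sort f).symm (fun j hj => ?_)
      (Equiv.injective _).injOn
    simp only [Finset.coe_filter, Finset.mem_univ, true_and, Set.mem_ofPred_eq] at hj
    simp only [Finset.coe_Iio, Set.mem_Iio]
    by_contra! hij
    have := Tuple.monotone_sort f hij
    simp only [Function.comp_apply, Equiv.apply_symm_apply] at this
    linarith
  simp at hcard
  omega

/-- Lemma 4.2: ordering the uniform shifts.  The coordinates of `Fin m` represent the indices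
{1,…,m} via `i ↦ i.val + 1`. -/
theorem small_shifts_exist :
    ∃ c0 c1 : ℝ, 0 < c0 ∧ 0 < c1 ∧
      ∀ (m k : ℕ) (lam : ℝ), 0 < lam → 2 * k ≤ m →
        ENNReal.ofReal (1 - c0 * Real.exp (-c1 * k)) ≤
          unifCube m lam
            {τ | ∃ σ : Equiv.Perm (Fin m), ∀ i : Fin m,
              (k : ℝ) / 2 ≤ ((i : ℕ) + 1 : ℝ) → ((i : ℕ) + 1 : ℝ) ≤ k →
                |τ (σ i)| / lam ≤ 2 * ((i : ℕ) + 1) / m} := by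
  classical
  set r : ℝ := 2 * exp (-1) with hr
  have hr0 : 0 < r := by positivity
  have hr1 : r < 1 := by
    have h2 : (2 : ℝ) < exp 1 := by linarith [exp_one_gt_d9]
    rw [hr, exp_neg, ← div_eq_mul_inv, div_lt_one (exp_pos 1)]
    exact h2
  have hlog : log r < 0 := log_neg hr0 hr1
  refine ⟨(1 - r)⁻¹, -log r / 2, inv_pos.mpr (by linarith), by linarith, ?_⟩
  intro m k lam hlam hkm
  have := isProbabilityMeasure_unifInterval hlam
  rw [unifCube_eq_pi m hlam]
  set μ := Measure.pi fun _ : Fin m => unifInterval lam with hμ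
  set good : Set (Fin m → ℝ) := {τ | ∃ σ : Equiv.Perm (Fin m), ∀ i : Fin m,
    (k : ℝ) / 2 ≤ ((i : ℕ) + 1 : ℝ) → ((i : ℕ) + 1 : ℝ) ≤ k →
      |τ (σ i)| / lam ≤ 2 * ((i : ℕ) + 1) / m} with hgood
  set bad : ℕ → Set (Fin m → ℝ) := fun n =>
    {τ | (Finset.univ.filter fun j => τ j ∈ {x : ℝ | |x| / lam ≤ 2 * n / m}).card < n} with hbad
  set a : ℕ := (k + 1) / 2 with ha
  have hcover : Set.univ ⊆ good ∪ ⋃ n ∈ Finset.Icc a k, bad n := by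
    intro τ _
    by_contra hτ
    simp only [Set.mem_union, Set.mem_iUnion, not_or, not_exists] at hτ
    obtain ⟨hτ1, hτ2⟩ := hτ
    refine hτ1 ⟨Tuple.sort fun j => |τ j| / lam, fun i hi1 hi2 => ?_⟩
    have hi2' : (i : ℕ) + 1 ≤ k := by exact_mod_cast hi2
    have hi1' : k ≤ 2 * ((i : ℕ) + 1) := by
      rw [div_le_iff₀ two_pos] at hi1
      have : (k : ℝ) ≤ ((2 * ((i : ℕ) + 1) : ℕ) : ℝ) := by push_cast; linarith
      exact_mod_cast this
    have hb := hτ2 ((i : ℕ) + 1) (Finset.mem_Icc.mpr ⟨by omega, hi2'⟩)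
    simp only [hbad, Set.mem_ofPred_eq, not_lt, Nat.cast_add, Nat.cast_one] at hb
    exact apply_sort_le_of_lt_card (fun j => |τ j| / lam) _ i hb
  have hbad_le (n : ℕ) (hn : n ∈ Finset.Icc a k) : μ.real (bad n) ≤ r ^ n := by
    rw [Finset.mem_Icc] at hn
    obtain rfl | hm := Nat.eq_zero_or_pos m
    · have : n = 0 := by omega
      subst this
      simp [hbad]
    have hm' : (0 : ℝ) < m := by exact_mod_cast hm
    have h2n : (2 * n : ℝ) ≤ m := by exact_mod_cast (by omega : 2 * n ≤ m)
    have hA : MeasurableSet {x : ℝ | |x| / lam ≤ 2 * n / m} :=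
      measurableSet_le (by fun_prop) (by fun_prop)
    refine (measureReal_pi_card_lt_le (unifInterval lam) hA n).trans_eq ?_
    rw [unifInterval_real_abs_div_le hlam (by positivity) ((div_le_one hm').mpr h2n),
      Fintype.card_fin, hr, mul_pow, ← exp_nat_mul]
    congr 2
    field_simp
  have hsum : ∑ n ∈ Finset.Icc a k, r ^ n ≤ (1 - r)⁻¹ * exp (-(-log r / 2) * k) := by
    have hgeom : ∑ n ∈ Finset.Icc a k, r ^ n ≤ r ^ a / (1 - r) := by
      rw [← Finset.Ico_add_one_right_eq_Icc]
      exact geom_sum_Ico_le_of_lt_one hr0.le hr1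
    have hpow : r ^ a ≤ exp (-(-log r / 2) * k) := by
      have hak : (k : ℝ) ≤ 2 * a := by exact_mod_cast (by omega : k ≤ 2 * a)
      rw [← exp_log hr0, ← exp_nat_mul, log_exp, exp_le_exp]
      nlinarith
    rw [div_eq_inv_mul] at hgeom
    exact hgeom.trans (by gcongr)
  have hunion : (1 : ℝ) ≤ μ.real good + ∑ n ∈ Finset.Icc a k, r ^ n :=
    calc (1 : ℝ) = μ.real Set.univ := by simp
      _ ≤ μ.real (good ∪ ⋃ n ∈ Finset.Icc a k, bad n) := measureReal_mono hcover
      _ ≤ μ.real good + μ.real (⋃ n ∈ Finset.Icc a k, bad n) := measureReal_union_le _ _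
      _ ≤ μ.real good + ∑ n ∈ Finset.Icc a k, μ.real (bad n) := by
          gcongr; exact measureReal_biUnion_finset_le _ _
      _ ≤ _ := by gcongr with n hn; exact hbad_le n hn
  exact ENNReal.ofReal_le_of_le_toReal (by rw [← measureReal_def]; linarith)

end
end
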